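/- Assume the hypotheses and conclusions of the regularity theorem on the q-quadratic lattice (context), with 0 < q < 1, and let B_n be the recurrence coefficients of the monic OPS, i.e. B₀ = 𝔠₃ − e₀/d₀ and B_n = 𝔠₃ + γ_n e_{n−1}/d_{2n−2} − γ_{n+1} e_n/d_{2n} for n ≥ 1. Set λ := (q^{1/2} − q^{−1/2})^{−1} and assume d − 2aλ ≠ 0. Then: (i) for every n ≥ 1, Σ_{j=0}^{n−1}(B_j − 𝔠₃) = −γ_n e_{n−1}/d_{2n−2}; (ii) lim_{n→∞}(B_n − 𝔠₃) = 0 and lim_{n→∞} q^{±n/2}(B_n − 𝔠₃) = 0; (iii) lim_{n→∞} q^{−n}(B_n − 𝔠₃) = −q^{−1/2}( ψ(𝔠₃) − 4αλ²φ′(𝔠₃) ) / ( λ(d − 2aλ) ); and (iv) Σ_{j=0}^{∞}(B_j − 𝔠₃) = ( ψ(𝔠₃) − 2λφ′(𝔠₃) ) / ( (q−1)(d − 2aλ) ). -/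

import Mathlib

open Polynomial

noncomputable def qp (q : ℝ) (t : ℂ) : ℂ := Complex.exp (t * (Real.log q : ℂ))

noncomputable def alphaL (q : ℝ) : ℂ := (qp q (1/2) + qp q (-(1/2))) / 2

noncomputable def alphaN (q : ℝ) (n : ℕ) : ℂ :=
  (qp q ((n : ℂ) / 2) + qp q (-((n : ℂ) / 2))) / 2

noncomputable def gammaN (q : ℝ) (n : ℕ) : ℂ :=
  (qp q ((n : ℂ) / 2) - qp q (-((n : ℂ) / 2))) / (qp q (1/2) - qp q (-(1/2)))

noncomputable def latX (q : ℝ) (c1 c2 c3 s : ℂ) : ℂ := c1 * qp q (-s) + c2 * qp q s + c3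

noncomputable def dN (q : ℝ) (pa pd : ℂ) (n : ℕ) : ℂ := pa * gammaN q n + pd * alphaN q n

noncomputable def eN (q : ℝ) (pa pb pd pe c3 : ℂ) (n : ℕ) : ℂ :=
  (2 * pa * c3 + pb) * gammaN q n + (pd * c3 + pe) * alphaN q n

noncomputable def lamQ (q : ℝ) : ℂ := (qp q (1/2) - qp q (-(1/2)))⁻¹

open Filter Topology

lemma qp_half_ne_zero (q : ℝ) : qp q (1/2) ≠ 0 := Complex.exp_ne_zero _

lemma qp_neg (q : ℝ) (t : ℂ) : qp q (-t) = (qp q t)⁻¹ := by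
  rw [qp, qp, neg_mul, Complex.exp_neg]

lemma qp_natCast_div_two (q : ℝ) (n : ℕ) : qp q ((n : ℂ) / 2) = qp q (1/2) ^ n := by
  rw [qp, qp, ← Complex.exp_nat_mul]
  congr 1
  ring

lemma qp_natCast (q : ℝ) (n : ℕ) : qp q (n : ℂ) = (qp q (1/2) ^ 2) ^ n := by
  rw [qp, qp, ← pow_mul, ← Complex.exp_nat_mul]
  congr 1
  push_cast
  ring

lemma qp_half_sq {q : ℝ} (hq : 0 < q) : qp q (1/2) ^ 2 = q := by
  rw [qp, ← Complex.exp_nat_mul, Nat.cast_ofNat, ← mul_assoc, mul_one_div_cancel two_ne_zero,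
    one_mul, ← Complex.ofReal_exp, Real.exp_log hq]

lemma norm_qp_half_lt_one {q : ℝ} (hq : 0 < q) (hq1 : q < 1) : ‖qp q (1/2)‖ < 1 := by
  have h : ‖qp q (1/2)‖ ^ 2 = q := by
    rw [← norm_pow, qp_half_sq hq, Complex.norm_real, Real.norm_of_nonneg hq.le]
  exact (sq_lt_one_iff₀ (norm_nonneg _)).1 (h.trans_lt hq1)

lemma qp_half_sub_inv_ne_zero {q : ℝ} (hq : 0 < q) (hq1 : q < 1) :
    qp q (1/2) - (qp q (1/2))⁻¹ ≠ 0 := by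
  intro h
  have h1 : qp q (1/2) ^ 2 = 1 := by
    rw [sq]
    nth_rewrite 2 [sub_eq_zero.1 h]
    exact mul_inv_cancel₀ (qp_half_ne_zero q)
  rw [qp_half_sq hq] at h1
  exact hq1.ne (by exact_mod_cast h1)

lemma gammaN_eq (q : ℝ) (n : ℕ) :
    gammaN q n = lamQ q * (qp q (1/2) ^ n - (qp q (1/2) ^ n)⁻¹) := by
  rw [gammaN, lamQ, qp_neg q (n / 2), qp_natCast_div_two, div_eq_inv_mul]

lemma gammaN_one {q : ℝ} (hq : 0 < q) (hq1 : q < 1) : gammaN q 1 = 1 := by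
  rw [gammaN_eq, lamQ, qp_neg, pow_one]
  exact inv_mul_cancel₀ (qp_half_sub_inv_ne_zero hq hq1)

lemma mul_gammaN_add_mul_alphaN (q : ℝ) (a b : ℂ) (n : ℕ) :
    a * gammaN q n + b * alphaN q n =
      (b / 2 + a * lamQ q) * qp q (1/2) ^ n + (b / 2 - a * lamQ q) * (qp q (1/2) ^ n)⁻¹ := by
  rw [gammaN_eq, alphaN, qp_neg, qp_natCast_div_two]
  ring

/-- First-order expansion in `r ^ (2 * m)` of the quotient giving the partial sums of the
shifted recurrence coefficients. -/
lemma gamma_mul_e_div_d_expansion {r l E E' D D' : ℂ} (hr : r ≠ 0) (hD : D ≠ 0) (m : ℕ)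
    (hden : D' * r ^ (2 * m) + D * (r ^ (2 * m))⁻¹ ≠ 0) :
    -(l * (r ^ (m + 1) - (r ^ (m + 1))⁻¹) * (E' * r ^ m + E * (r ^ m)⁻¹) /
        (D' * r ^ (2 * m) + D * (r ^ (2 * m))⁻¹)) =
      l / r * E / D + (r ^ 2) ^ m *
        (-(l / r) * (r ^ 2 * E - E' + (r ^ 2) ^ m * (r ^ 2 * E' + E * D' / D)) /
          (((r ^ 2) ^ m) ^ 2 * D' + D)) := by
  have h1 : r ^ (2 * m) = (r ^ m) ^ 2 := by rw [← pow_mul, mul_comm]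
  have h2 : (r ^ 2) ^ m = (r ^ m) ^ 2 := by rw [← pow_mul, ← pow_mul, mul_comm]
  have hs : r ^ m ≠ 0 := pow_ne_zero _ hr
  rw [h1] at hden ⊢
  rw [h2, pow_succ]
  generalize r ^ m = s at *
  have hden' : (s ^ 2) ^ 2 * D' + D ≠ 0 := by
    intro h
    apply hden
    field_simp
    linear_combination h
  have e1 : D' * s ^ 2 + D * (s ^ 2)⁻¹ = ((s ^ 2) ^ 2 * D' + D) / s ^ 2 := by
    field_simp
  rw [e1]
  generalize hw : (s ^ 2) ^ 2 * D' + D = w at *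
  field_simp
  rw [← hw]
  ring

lemma tendsto_expansion_coefficient {r : ℂ} (hr1 : ‖r‖ < 1) (k E E' D D' : ℂ) (hD : D ≠ 0) :
    Tendsto (fun m : ℕ => k * (r ^ 2 * E - E' + (r ^ 2) ^ m * (r ^ 2 * E' + E * D' / D)) /
        (((r ^ 2) ^ m) ^ 2 * D' + D)) atTop (𝓝 (k * (r ^ 2 * E - E') / D)) := by
  have hw : Tendsto (fun m : ℕ => (r ^ 2) ^ m) atTop (𝓝 0) :=
    tendsto_pow_atTop_nhds_zero_of_norm_lt_one (by
      rw [norm_pow]; exact pow_lt_one₀ (norm_nonneg _) hr1 two_ne_zero)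
  have hnum := ((hw.mul_const (r ^ 2 * E' + E * D' / D)).const_add (r ^ 2 * E - E')).const_mul k
  have hdenom := ((hw.pow 2).mul_const D').add_const D
  have h := hnum.div hdenom (by simpa using hD)
  simpa [Pi.div_def] using h

theorem stmt_14 (q : ℝ) (hq : 0 < q) (hq1 : q < 1) (c1 c2 c3 : ℂ) (hc : c1 * c2 ≠ 0)
    (Dx Sx : Polynomial ℂ → Polynomial ℂ)
    (hDx : ∀ (f : Polynomial ℂ) (s : ℂ),
      latX q c1 c2 c3 (s + 1/2) ≠ latX q c1 c2 c3 (s - 1/2) →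
      (Dx f).eval (latX q c1 c2 c3 s) =
        (f.eval (latX q c1 c2 c3 (s + 1/2)) - f.eval (latX q c1 c2 c3 (s - 1/2))) /
          (latX q c1 c2 c3 (s + 1/2) - latX q c1 c2 c3 (s - 1/2)))
    (hSx : ∀ (f : Polynomial ℂ) (s : ℂ),
      (Sx f).eval (latX q c1 c2 c3 s) =
        (f.eval (latX q c1 c2 c3 (s + 1/2)) + f.eval (latX q c1 c2 c3 (s - 1/2))) / 2)
    (pa pb pc pd pe : ℂ)
    (hne : ¬(pa = 0 ∧ pb = 0 ∧ pc = 0 ∧ pd = 0 ∧ pe = 0))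
    (u : Polynomial ℂ →ₗ[ℂ] ℂ)
    (P : ℕ → Polynomial ℂ)
    (hPm : ∀ n, (P n).Monic) (hPd : ∀ n, (P n).natDegree = n)
    (hPo : ∀ n m, n ≠ m → u (P n * P m) = 0)
    (hPn : ∀ n, u (P n * P n) ≠ 0)
    (hu : u ≠ 0)
    (hPearson : ∀ f : Polynomial ℂ,
      u ((C pa * X ^ 2 + C pb * X + C pc) * Dx f) + u ((C pd * X + C pe) * Sx f) = 0)
    (hd : ∀ n : ℕ, dN q pa pd n ≠ 0)
    (B Cc : ℕ → ℂ)
    (hT1 : P 1 = (X - C (B 0)) * P 0)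
    (hT : ∀ n, 1 ≤ n → P (n + 1) = (X - C (B n)) * P n - C (Cc n) * P (n - 1))
    (hCne : ∀ n, 1 ≤ n → Cc n ≠ 0)
    (hB0 : B 0 = c3 - eN q pa pb pd pe c3 0 / dN q pa pd 0)
    (hBn : ∀ n : ℕ, 1 ≤ n →
      B n = c3 + gammaN q n * eN q pa pb pd pe c3 (n - 1) / dN q pa pd (2 * n - 2) -
        gammaN q (n + 1) * eN q pa pb pd pe c3 n / dN q pa pd (2 * n))
    (hlam : pd - 2 * pa * lamQ q ≠ 0) :
    (∀ n : ℕ, 1 ≤ n →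
      ∑ j ∈ Finset.range n, (B j - c3) =
        -(gammaN q n * eN q pa pb pd pe c3 (n - 1) / dN q pa pd (2 * n - 2))) ∧
    Filter.Tendsto (fun n : ℕ => B n - c3) Filter.atTop (nhds 0) ∧
    Filter.Tendsto (fun n : ℕ => qp q ((n : ℂ) / 2) * (B n - c3)) Filter.atTop (nhds 0) ∧
    Filter.Tendsto (fun n : ℕ => qp q (-((n : ℂ) / 2)) * (B n - c3)) Filter.atTop (nhds 0) ∧
    Filter.Tendsto (fun n : ℕ => qp q (-(n : ℂ)) * (B n - c3)) Filter.atTop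
      (nhds (-(qp q (-(1/2)) * ((pd * c3 + pe) - 4 * alphaL q * lamQ q ^ 2 * (2 * pa * c3 + pb))) /
        (lamQ q * (pd - 2 * pa * lamQ q)))) ∧
    Filter.Tendsto (fun n : ℕ => ∑ j ∈ Finset.range n, (B j - c3)) Filter.atTop
      (nhds (((pd * c3 + pe) - 2 * lamQ q * (2 * pa * c3 + pb)) /
        (((q : ℂ) - 1) * (pd - 2 * pa * lamQ q)))) := by
  set r := qp q (1/2) with hr
  set l := lamQ q with hl
  set F := 2 * pa * c3 + pb with hF
  set G := pd * c3 + pe with hG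
  have hr0 : r ≠ 0 := qp_half_ne_zero q
  have hr1 : ‖r‖ < 1 := norm_qp_half_lt_one hq hq1
  have hrq : r ^ 2 = q := qp_half_sq hq
  have hrr : r - r⁻¹ ≠ 0 := qp_half_sub_inv_ne_zero hq hq1
  have hll : l = (r - r⁻¹)⁻¹ := by rw [hl, lamQ, qp_neg]
  have hlr : l * (r ^ 2 - 1) = r := by
    rw [hll, inv_mul_eq_div, div_eq_iff hrr]
    field_simp
  have hr21 : r ^ 2 - 1 ≠ 0 := right_ne_zero_of_mul (hlr ▸ hr0)
  have hD : pd / 2 - pa * l ≠ 0 := fun h => hlam (by linear_combination 2 * h)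
  have hsum : ∀ m : ℕ, ∑ j ∈ Finset.range (m + 1), (B j - c3) =
      -(gammaN q (m + 1) * eN q pa pb pd pe c3 m / dN q pa pd (2 * m)) := by
    intro m
    induction m with
    | zero => simp [hB0, gammaN_one hq hq1]
    | succ k ih =>
      rw [Finset.sum_range_succ, ih, hBn (k + 1) (by omega), Nat.add_sub_cancel,
        show 2 * (k + 1) - 2 = 2 * k by omega]
      ring
  set E := G / 2 - F * l with hE
  set E' := G / 2 + F * l with hE'
  set D := pd / 2 - pa * l with hDd
  set D' := pd / 2 + pa * l with hDd'
  set H : ℕ → ℂ := fun m =>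
    -(l / r) * (r ^ 2 * E - E' + (r ^ 2) ^ m * (r ^ 2 * E' + E * D' / D)) /
      (((r ^ 2) ^ m) ^ 2 * D' + D) with hH
  have hexp : ∀ m : ℕ, ∑ j ∈ Finset.range (m + 1), (B j - c3) =
      l / r * E / D + (r ^ 2) ^ m * H m := by
    intro m
    have hdm := hd (2 * m)
    rw [dN, mul_gammaN_add_mul_alphaN] at hdm
    rw [hsum, dN, eN, mul_gammaN_add_mul_alphaN, mul_gammaN_add_mul_alphaN, gammaN_eq]
    exact gamma_mul_e_div_d_expansion hr0 hD m hdm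
  have hHlim : Tendsto H atTop (𝓝 (-(l / r) * (r ^ 2 * E - E') / D)) :=
    tendsto_expansion_coefficient hr1 _ E E' D D' hD
  clear_value H E E' D D' F G l r
  have hpow : Tendsto (fun m : ℕ => r ^ m) atTop (𝓝 0) :=
    tendsto_pow_atTop_nhds_zero_of_norm_lt_one hr1
  have hpow2 : Tendsto (fun m : ℕ => (r ^ 2) ^ m) atTop (𝓝 0) := by
    simpa [← pow_mul, mul_comm] using hpow.pow 2
  have hB : ∀ m : ℕ, B (m + 1) - c3 = (r ^ 2) ^ (m + 1) * (H (m + 1) - (r ^ 2)⁻¹ * H m) := by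
    intro m
    have h := hexp (m + 1)
    rw [Finset.sum_range_succ, hexp m] at h
    have hcancel : (r ^ 2) ^ (m + 1) * (r ^ 2)⁻¹ = (r ^ 2) ^ m := by
      rw [pow_succ, mul_inv_cancel_right₀ (pow_ne_zero _ hr0)]
    linear_combination h + H m * hcancel
  have hlim : Tendsto (fun n : ℕ => qp q (-(n : ℂ)) * (B n - c3)) atTop
      (𝓝 (-(qp q (-(1/2)) * (G - 4 * alphaL q * l ^ 2 * F)) / (l * (pd - 2 * pa * l)))) := by
    rw [← tendsto_add_atTop_iff_nat 1]
    have h := ((tendsto_add_atTop_iff_nat 1).2 hHlim).sub (hHlim.const_mul (r ^ 2)⁻¹)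
    convert h using 2 with m
    · rw [qp_neg, qp_natCast, ← hr, hB, inv_mul_cancel_left₀]
      exact pow_ne_zero _ (pow_ne_zero _ hr0)
    · have hα : alphaL q = (r + r⁻¹) / 2 := by rw [alphaL, qp_neg, ← hr]
      have hpd : pd - 2 * pa * l = 2 * D := by rw [hDd]; ring
      have hl' : l = r / (r ^ 2 - 1) := eq_div_of_mul_eq hr21 hlr
      rw [qp_neg, ← hr, hα, hpd, hE, hE', hl']
      field_simp
      ring
  have hscaled : ∀ n : ℕ, B n - c3 = (r ^ 2) ^ n * (qp q (-(n : ℂ)) * (B n - c3)) := by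
    intro n
    rw [qp_neg, qp_natCast, ← hr, mul_inv_cancel_left₀]
    exact pow_ne_zero _ (pow_ne_zero _ hr0)
  have hBlim : Tendsto (fun n : ℕ => B n - c3) atTop (𝓝 0) := by
    have h := hpow2.mul hlim
    rw [zero_mul] at h
    exact h.congr fun n => (hscaled n).symm
  refine ⟨?_, hBlim, ?_, ?_, hlim, ?_⟩
  · intro n hn
    obtain ⟨m, rfl⟩ := Nat.exists_eq_add_of_le' hn
    rw [hsum, Nat.add_sub_cancel, show 2 * (m + 1) - 2 = 2 * m by omega]
  · simpa only [qp_natCast_div_two, ← hr, zero_mul, mul_zero] using hpow.mul hBlim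
  · have h := hpow.mul hlim
    rw [zero_mul] at h
    refine h.congr fun n => ?_
    rw [qp_neg, qp_neg, qp_natCast, qp_natCast_div_two, ← hr]
    have hrn : r ^ n ≠ 0 := pow_ne_zero _ hr0
    rw [show (r ^ 2) ^ n = r ^ n * r ^ n by rw [← mul_pow, sq]]
    field_simp
  · rw [← tendsto_add_atTop_iff_nat 1]
    have h := (hpow2.mul hHlim).const_add (l / r * E / D)
    rw [zero_mul, add_zero] at h
    convert h using 2 with m
    · exact hexp m
    · have hpd : pd - 2 * pa * l = 2 * D := by rw [hDd]; ring
      have hlr' : l / r = 1 / (r ^ 2 - 1) := by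
        rw [div_eq_div_iff hr0 hr21, hlr, one_mul]
      rw [← hrq, hpd, hlr', hE]
      field_simp
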